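/- Fix integers 1 ≤ m < n, constants R, L, d > 0 and α ∈ (0,1]. Then every sequence (Σ_j) of sets belonging to the class C^{1,α}_{m,n}(R,L,d) contains a subsequence that converges in the C^{1,α} graph-patch sense to some set Σ₀ that again belongs to C^{1,α}_{m,n}(R,L,d). -/

import Mathlib

open Set Metric MeasureTheory Filter Topology
open scoped ENNReal NNReal
noncomputable section

/-- `T` is an `m`-dimensional tangent plane for `S` at `x`, over which `S ∩ B(x,R)` is the
graph of a `1`-Lipschitz `C¹` function `f` with `f(0) = 0`, `Df(0) = 0` and `α`-Hölder
derivative with constant `L`. -/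
def IsGraphPatchAt (m n : ℕ) (R L α : ℝ) (S : Set (EuclideanSpace ℝ (Fin n)))
    (x : EuclideanSpace ℝ (Fin n)) (T : Submodule ℝ (EuclideanSpace ℝ (Fin n))) : Prop :=
  Module.finrank ℝ T = m ∧
  ∃ f : T → Tᗮ, ContDiff ℝ 1 f ∧ f 0 = 0 ∧ fderiv ℝ f 0 = 0 ∧ LipschitzWith 1 f ∧
    (∀ ξ η : T, ‖fderiv ℝ f ξ - fderiv ℝ f η‖ ≤ L * ‖ξ - η‖ ^ α) ∧
    S ∩ Metric.ball x R
      = (Set.range fun ξ : T =>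
          x + (ξ : EuclideanSpace ℝ (Fin n)) + (f ξ : EuclideanSpace ℝ (Fin n)))
        ∩ Metric.ball x R

/-- The class `C^{1,α}_{m,n}(R,L,d)`: nonempty compact subsets of the closed ball of radius
`d` admitting uniform `C^{1,α}` graph patches at scale `R` with Hölder constant `L`. -/
def InClassC1 (m n : ℕ) (R L d α : ℝ) (S : Set (EuclideanSpace ℝ (Fin n))) : Prop :=
  S.Nonempty ∧ IsCompact S ∧ S ⊆ Metric.closedBall 0 d ∧
  ∀ x ∈ S, ∃ T : Submodule ℝ (EuclideanSpace ℝ (Fin n)), IsGraphPatchAt m n R L α S x T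

/-- A compact embedded `m`-dimensional submanifold of `ℝⁿ` of class `C^{1,α}`. -/
def IsC1AlphaSubmanifold (m n : ℕ) (α : ℝ) (S : Set (EuclideanSpace ℝ (Fin n))) : Prop :=
  S.Nonempty ∧ IsCompact S ∧
  ∀ x ∈ S, ∃ r : ℝ, 0 < r ∧ ∃ T : Submodule ℝ (EuclideanSpace ℝ (Fin n)),
    Module.finrank ℝ T = m ∧ ∃ f : T → Tᗮ, ContDiff ℝ 1 f ∧
      (∃ C : ℝ, ∀ ξ η : T, ‖fderiv ℝ f ξ - fderiv ℝ f η‖ ≤ C * ‖ξ - η‖ ^ α) ∧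
      S ∩ Metric.ball x r
        = (Set.range fun ξ : T =>
            x + (ξ : EuclideanSpace ℝ (Fin n)) + (f ξ : EuclideanSpace ℝ (Fin n)))
          ∩ Metric.ball x r

/-- `f` is `C¹` with `α`-Hölder derivative. -/
def C1Holder {E F : Type*} [NormedAddCommGroup E] [NormedSpace ℝ E]
    [NormedAddCommGroup F] [NormedSpace ℝ F] (α : ℝ) (f : E → F) : Prop :=
  ContDiff ℝ 1 f ∧ ∃ C : ℝ, ∀ ξ η : E, ‖fderiv ℝ f ξ - fderiv ℝ f η‖ ≤ C * ‖ξ - η‖ ^ α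

/-- `‖f − g‖_{C^{1,α'}} ≤ ε`: uniform closeness of the functions, of their derivatives, and
`ε`-smallness of the `α'`-Hölder seminorm of the difference of the derivatives. -/
def C1HolderClose {E F : Type*} [NormedAddCommGroup E] [NormedSpace ℝ E]
    [NormedAddCommGroup F] [NormedSpace ℝ F] (α' ε : ℝ) (f g : E → F) : Prop :=
  (∀ ξ : E, ‖f ξ - g ξ‖ ≤ ε) ∧ (∀ ξ : E, ‖fderiv ℝ f ξ - fderiv ℝ g ξ‖ ≤ ε) ∧
  ∀ ξ η : E, ‖(fderiv ℝ f ξ - fderiv ℝ g ξ) - (fderiv ℝ f η - fderiv ℝ g η)‖ ≤ ε * ‖ξ - η‖ ^ α'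

/-- Convergence of the sequence `Ss j` to `S₀` in the `C^{1,α}` graph-patch sense:
Hausdorff convergence, the limit is a `C^{1,α}` submanifold, and for large `j` both `Ss j`
and `S₀` are graphs over the tangent planes of `S₀` at a uniform scale `ρ`, the graph
functions of `Ss j` converging to those of `S₀` in `C^{1,α'}` for every `α' ∈ (0,α)`. -/
def GraphPatchConverges (m n : ℕ) (α : ℝ) (Ss : ℕ → Set (EuclideanSpace ℝ (Fin n)))
    (S₀ : Set (EuclideanSpace ℝ (Fin n))) : Prop :=
  Filter.Tendsto (fun j => Metric.hausdorffDist (Ss j) S₀) Filter.atTop (nhds 0) ∧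
  IsC1AlphaSubmanifold m n α S₀ ∧
  ∃ (j₀ : ℕ) (ρ : ℝ), 0 < ρ ∧ ∀ x ∈ S₀,
    ∃ T : Submodule ℝ (EuclideanSpace ℝ (Fin n)), Module.finrank ℝ T = m ∧
    ∃ (f : ℕ → T → Tᗮ) (f₀ : T → Tᗮ),
      (C1Holder α f₀ ∧
        S₀ ∩ Metric.ball x ρ
          = (Set.range fun ξ : T =>
              x + (ξ : EuclideanSpace ℝ (Fin n)) + (f₀ ξ : EuclideanSpace ℝ (Fin n)))
            ∩ Metric.ball x ρ) ∧
      (∀ j, j₀ ≤ j → C1Holder α (f j) ∧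
        Ss j ∩ Metric.ball x ρ
          = (Set.range fun ξ : T =>
              x + (ξ : EuclideanSpace ℝ (Fin n)) + (f j ξ : EuclideanSpace ℝ (Fin n)))
            ∩ Metric.ball x ρ) ∧
      (∀ α' : ℝ, 0 < α' → α' < α → ∀ ε : ℝ, 0 < ε →
        ∃ J : ℕ, ∀ j, J ≤ j → C1HolderClose α' ε (f j) f₀)


lemma aa0 {X Y : Type*} [MetricSpace X] [ProperSpace X] [MetricSpace Y] [ProperSpace Y]
    (C β : ℝ) (hβ : 0 < β) (F : ℕ → X → Y)
    (hF : ∀ j a b, dist (F j a) (F j b) ≤ C * dist a b ^ β) (x0 : X) (y0 : Y) (M : ℝ)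
    (hM : ∀ j, dist (F j x0) y0 ≤ M) :
    ∃ φ : ℕ → ℕ, StrictMono φ ∧ ∃ G : X → Y, Continuous G ∧
      ∀ K, IsCompact K → TendstoUniformlyOn (fun j => F (φ j)) G atTop K := by
  have hmod : Tendsto (fun t : ℝ => C * t ^ β) (𝓝 0) (𝓝 0) := by
    have := (Real.continuousAt_rpow_const 0 β (Or.inr hβ.le)).tendsto.const_mul C
    simpa [Real.zero_rpow hβ.ne'] using this
  have hcont : ∀ p : X → Y, (∀ a b, dist (p a) (p b) ≤ C * dist a b ^ β) → Continuous p := by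
    intro p hp
    rw [continuous_iff_continuousAt]
    intro a
    rw [ContinuousAt, tendsto_iff_dist_tendsto_zero]
    refine squeeze_zero (fun _ => dist_nonneg) (fun b => hp b a) ?_
    have h1 : Tendsto (fun b => dist b a) (𝓝 a) (𝓝 0) := by
      have := (continuous_id.dist (continuous_const (y := a))).tendsto a
      simpa using this
    exact hmod.comp h1
  let S : Set C(X, Y) := {p | (∀ a b, dist (p a) (p b) ≤ C * dist a b ^ β) ∧ dist (p x0) y0 ≤ M}
  have hS : IsCompact S := by
    apply ArzelaAscoli.isCompact_of_equicontinuous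
    · have himg : ContinuousMap.toFun '' S =
          (Set.pi univ fun a => closedBall y0 (C * dist a x0 ^ β + M)) ∩
          {p : X → Y | (∀ a b, dist (p a) (p b) ≤ C * dist a b ^ β) ∧ dist (p x0) y0 ≤ M} := by
        ext p
        constructor
        · rintro ⟨q, hq, rfl⟩
          refine ⟨fun a _ => ?_, hq⟩
          have := dist_triangle (q a) (q x0) y0
          have h2 := hq.1 a x0
          have h3 := hq.2
          simp only [mem_closedBall]
          show dist (q a) y0 ≤ _
          linarith
        · rintro ⟨-, hp⟩
          exact ⟨⟨p, hcont p hp.1⟩, hp, rfl⟩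
      rw [himg]
      apply (isCompact_univ_pi fun a => isCompact_closedBall y0 _).inter_right
      have : {p : X → Y | (∀ a b, dist (p a) (p b) ≤ C * dist a b ^ β) ∧ dist (p x0) y0 ≤ M}
        = (⋂ a, ⋂ b, {p : X → Y | dist (p a) (p b) ≤ C * dist a b ^ β}) ∩
          {p | dist (p x0) y0 ≤ M} := by
        ext p; simp
      rw [this]
      apply IsClosed.inter
      · exact isClosed_iInter fun a => isClosed_iInter fun b =>
          isClosed_le (by fun_prop) continuous_const
      · exact isClosed_le (by fun_prop) continuous_const
    · apply Metric.equicontinuous_of_continuity_modulus (fun t => C * t ^ β) hmod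
      intro a b p
      exact p.2.1 a b
  obtain ⟨G, -, φ, hφ, h⟩ := hS.tendsto_subseq (x := fun j => (⟨F j, hcont _ (hF j)⟩ : C(X, Y)))
    (fun j => ⟨hF j, hM j⟩)
  refine ⟨φ, hφ, G, G.continuous, ?_⟩
  rw [ContinuousMap.tendsto_iff_forall_isCompact_tendstoUniformlyOn] at h
  exact h

structure Reg {E F : Type*} [NormedAddCommGroup E] [NormedSpace ℝ E]
    [NormedAddCommGroup F] [NormedSpace ℝ F] (K C α : ℝ) (g : E → F) : Prop where
  cd : ContDiff ℝ 1 g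
  bd : ∀ ξ, ‖fderiv ℝ g ξ‖ ≤ K
  ho : ∀ ξ η, ‖fderiv ℝ g ξ - fderiv ℝ g η‖ ≤ C * ‖ξ - η‖ ^ α

section regs
variable {E F G H : Type*} [NormedAddCommGroup E] [NormedSpace ℝ E]
    [NormedAddCommGroup F] [NormedSpace ℝ F] [NormedAddCommGroup G] [NormedSpace ℝ G]
    [NormedAddCommGroup H] [NormedSpace ℝ H]

lemma Reg.K0 {K C α : ℝ} {g : E → F} (h : Reg K C α g) : 0 ≤ K := (norm_nonneg _).trans (h.bd 0)

lemma Reg.diff {K C α : ℝ} {g : E → F} (h : Reg K C α g) : Differentiable ℝ g :=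
  h.cd.differentiable one_ne_zero

lemma Reg.lip {K C α : ℝ} {g : E → F} (h : Reg K C α g) (a b : E) :
    ‖g a - g b‖ ≤ K * ‖a - b‖ :=
  convex_univ.norm_image_sub_le_of_norm_fderiv_le (𝕜 := ℝ) (fun x _ => h.diff x)
    (fun x _ => h.bd x) (mem_univ b) (mem_univ a)

lemma Reg.C0 {K C α : ℝ} {g : E → F} (h : Reg K C α g) {a b : E} (hab : a ≠ b) : 0 ≤ C := by
  have h1 := h.ho a b
  have h2 : 0 < ‖a - b‖ ^ α := Real.rpow_pos_of_pos (norm_pos_iff.2 (sub_ne_zero.2 hab)) _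
  by_contra! h3
  have := norm_nonneg (fderiv ℝ g a - fderiv ℝ g b)
  nlinarith

lemma Reg.comp {K C K' C' α : ℝ} (hα : 0 ≤ α) (hC : 0 ≤ C) {g : F → G} {p : E → F}
    (hg : Reg K C α g) (hp : Reg K' C' α p) :
    Reg (K * K') (C * K' ^ α * K' + K * C') α (g ∘ p) := by
  have hd : ∀ ξ, fderiv ℝ (g ∘ p) ξ = (fderiv ℝ g (p ξ)).comp (fderiv ℝ p ξ) := fun ξ =>
    fderiv_comp ξ (hg.diff _) (hp.diff _)
  have hK := hg.K0
  have hK' := hp.K0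
  refine ⟨hg.cd.comp hp.cd, fun ξ => ?_, fun ξ η => ?_⟩
  · rw [hd]
    exact (ContinuousLinearMap.opNorm_comp_le _ _).trans
      (mul_le_mul (hg.bd _) (hp.bd _) (norm_nonneg _) hK)
  · rw [hd, hd]
    have e : (fderiv ℝ g (p ξ)).comp (fderiv ℝ p ξ) - (fderiv ℝ g (p η)).comp (fderiv ℝ p η)
      = (fderiv ℝ g (p ξ) - fderiv ℝ g (p η)).comp (fderiv ℝ p ξ)
        + (fderiv ℝ g (p η)).comp (fderiv ℝ p ξ - fderiv ℝ p η) := by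
      ext v; simp
    rw [e]
    have h1 : ‖p ξ - p η‖ ^ α ≤ K' ^ α * ‖ξ - η‖ ^ α := by
      rw [← Real.mul_rpow hK' (norm_nonneg _)]
      exact Real.rpow_le_rpow (norm_nonneg _) (hp.lip _ _) hα
    calc _ ≤ ‖fderiv ℝ g (p ξ) - fderiv ℝ g (p η)‖ * ‖fderiv ℝ p ξ‖
        + ‖fderiv ℝ g (p η)‖ * ‖fderiv ℝ p ξ - fderiv ℝ p η‖ :=
          (norm_add_le _ _).trans (add_le_add (ContinuousLinearMap.opNorm_comp_le _ _)
            (ContinuousLinearMap.opNorm_comp_le _ _))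
      _ ≤ (C * (K' ^ α * ‖ξ - η‖ ^ α)) * K' + K * (C' * ‖ξ - η‖ ^ α) := by
          apply add_le_add
          · apply mul_le_mul _ (hp.bd _) (norm_nonneg _) (by positivity)
            exact (hg.ho _ _).trans (mul_le_mul_of_nonneg_left h1 hC)
          · exact mul_le_mul (hg.bd _) (hp.ho _ _) (norm_nonneg _) hK
      _ = _ := by ring

lemma Reg.clm {α : ℝ} (A : E →L[ℝ] F) (c : F) : Reg ‖A‖ 0 α (fun x => A x + c) := by
  have : ∀ x, fderiv ℝ (fun x => A x + c) x = A := fun x => by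
    rw [fderiv_add_const]; exact A.fderiv
  refine ⟨by fun_prop, fun ξ => by rw [this], fun ξ η => by simp [this]⟩

lemma Reg.mono {K C K' C' α : ℝ} {g : E → F} (h : Reg K C α g) (hK : K ≤ K') (hC : C ≤ C') :
    Reg K' C' α g :=
  ⟨h.cd, fun ξ => (h.bd ξ).trans hK, fun ξ η => (h.ho ξ η).trans
    (mul_le_mul_of_nonneg_right hC (by positivity))⟩

lemma Reg.lcomp {K C α : ℝ} (hα : 0 ≤ α) (hC : 0 ≤ C) {g : E → F} (hg : Reg K C α g)
    (B : F →L[ℝ] G) (hB : ‖B‖ ≤ 1) (c : G) : Reg K C α (fun x => B (g x) + c) := by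
  have := Reg.comp hα le_rfl (Reg.clm (α := α) B c) hg
  refine this.mono ?_ ?_
  · exact mul_le_of_le_one_left hg.K0 hB
  · rw [zero_mul, zero_mul, zero_add]
    exact mul_le_of_le_one_left hC hB

lemma Reg.rcomp {K C α : ℝ} (hα : 0 ≤ α) (hC : 0 ≤ C) {g : F → G} (hg : Reg K C α g)
    (A : E →L[ℝ] F) (hA : ‖A‖ ≤ 1) (c : F) : Reg K C α (fun x => g (A x + c)) := by
  have := Reg.comp hα hC hg (Reg.clm (α := α) A c)
  refine this.mono ?_ ?_
  · exact mul_le_of_le_one_right hg.K0 hA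
  · rw [mul_zero, add_zero, mul_assoc]
    apply mul_le_of_le_one_right hC
    have : ‖A‖ ^ α ≤ 1 := Real.rpow_le_one (norm_nonneg _) hA hα
    nlinarith [norm_nonneg A, Real.rpow_nonneg (norm_nonneg A) α]

lemma aa1 [FiniteDimensional ℝ E] [FiniteDimensional ℝ F] {K C α M : ℝ} (hα : 0 < α)
    (g : ℕ → E → F) (hg : ∀ j, Reg K C α (g j)) (hM : ∀ j, ‖g j 0‖ ≤ M) :
    ∃ φ : ℕ → ℕ, StrictMono φ ∧ ∃ g₀ : E → F, Reg K C α g₀ ∧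
      (∀ S, IsCompact S → TendstoUniformlyOn (fun j => g (φ j)) g₀ atTop S) ∧
      (∀ S, IsCompact S → TendstoUniformlyOn (fun j => fderiv ℝ (g (φ j))) (fderiv ℝ g₀) atTop S)
      := by
  have := FiniteDimensional.proper ℝ E
  have := FiniteDimensional.proper ℝ F
  have := FiniteDimensional.proper ℝ (E →L[ℝ] F)
  obtain ⟨φ, hφ, g₀, -, h0⟩ := aa0 K 1 one_pos g (fun j a b => by
    rw [dist_eq_norm, dist_eq_norm, Real.rpow_one]; exact (hg j).lip a b) 0 0 M
    (fun j => by rw [dist_zero_right]; exact hM j)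
  obtain ⟨ψ, hψ, D, hDc, h1⟩ := aa0 C α hα (fun j => fderiv ℝ (g (φ j))) (fun j a b => by
    rw [dist_eq_norm, dist_eq_norm]; exact (hg _).ho a b) 0 0 K
    (fun j => by rw [dist_zero_right]; exact (hg _).bd 0)
  have h0' : ∀ S, IsCompact S → TendstoUniformlyOn (fun j => g (φ (ψ j))) g₀ atTop S := by
    intro S hS s hs
    exact hψ.tendsto_atTop.eventually (h0 S hS s hs)
  have hp0 : ∀ x, Tendsto (fun j => g (φ (ψ j)) x) atTop (𝓝 (g₀ x)) := fun x =>
    (h0' {x} isCompact_singleton).tendsto_at rfl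
  have hp1 : ∀ x, Tendsto (fun j => fderiv ℝ (g (φ (ψ j))) x) atTop (𝓝 (D x)) := fun x =>
    (h1 {x} isCompact_singleton).tendsto_at rfl
  have hD : ∀ x, HasFDerivAt g₀ (D x) x := by
    intro x
    refine hasFDerivAt_of_tendstoLocallyUniformlyOn (s := univ) isOpen_univ
      (f := fun j => g (φ (ψ j))) (f' := fun j => fderiv ℝ (g (φ (ψ j)))) (l := atTop) ?_
      (fun j x _ => ((hg _).diff x).hasFDerivAt) (fun x _ => hp0 x) (mem_univ x)
    rw [tendstoLocallyUniformlyOn_iff_forall_isCompact isOpen_univ]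
    exact fun S _ hS => h1 S hS
  have hDe : fderiv ℝ g₀ = D := funext fun x => (hD x).fderiv
  refine ⟨φ ∘ ψ, hφ.comp hψ, g₀, ⟨?_, ?_, ?_⟩, h0', ?_⟩
  · rw [contDiff_one_iff_fderiv, hDe]
    exact ⟨fun x => (hD x).differentiableAt, hDc⟩
  · intro ξ
    rw [hDe]
    exact le_of_tendsto (hp1 ξ).norm (Eventually.of_forall fun j => (hg _).bd ξ)
  · intro ξ η
    rw [hDe]
    exact le_of_tendsto ((hp1 ξ).sub (hp1 η)).norm (Eventually.of_forall fun j => (hg _).ho ξ η)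
  · rw [hDe]; exact h1
end regs

section regs2
variable {E F G H : Type*} [NormedAddCommGroup E] [NormedSpace ℝ E]
    [NormedAddCommGroup F] [NormedSpace ℝ F] [NormedAddCommGroup G] [NormedSpace ℝ G]
    [NormedAddCommGroup H] [NormedSpace ℝ H]

lemma Reg.add {K C K' C' α : ℝ} {g p : E → F} (hg : Reg K C α g) (hp : Reg K' C' α p) :
    Reg (K + K') (C + C') α (fun x => g x + p x) := by
  have hd : ∀ ξ, fderiv ℝ (fun x => g x + p x) ξ = fderiv ℝ g ξ + fderiv ℝ p ξ := fun ξ =>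
    fderiv_fun_add (hg.diff _) (hp.diff _)
  refine ⟨hg.cd.add hp.cd, fun ξ => ?_, fun ξ η => ?_⟩
  · rw [hd]
    exact (norm_add_le _ _).trans (add_le_add (hg.bd _) (hp.bd _))
  · rw [hd, hd, add_sub_add_comm, add_mul]
    exact (norm_add_le _ _).trans (add_le_add (hg.ho _ _) (hp.ho _ _))

lemma Reg.inv [FiniteDimensional ℝ E] {K C α : ℝ} (hα : 0 ≤ α) (hC : 0 ≤ C) {Φ : E → E}
    (hΦ : Reg K C α Φ) (hn : ∀ a b, ‖Φ a - Φ b - (a - b)‖ ≤ 1 / 2 * ‖a - b‖) :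
    ∃ Ψ : E → E, Reg 2 (4 * C * 2 ^ α) α Ψ ∧ (∀ y, Φ (Ψ y) = y) ∧ ∀ x, Ψ (Φ x) = x := by
  have := FiniteDimensional.complete ℝ E
  have hap : ApproximatesLinearOn Φ ((ContinuousLinearEquiv.refl ℝ E : E ≃L[ℝ] E) : E →L[ℝ] E)
      univ (1 / 2 : ℝ≥0) := by
    intro a _ b _
    simpa using hn a b
  have hc : Subsingleton E ∨ (1 / 2 : ℝ≥0) <
      ‖((ContinuousLinearEquiv.refl ℝ E).symm : E →L[ℝ] E)‖₊⁻¹ := by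
    rcases subsingleton_or_nontrivial E with h | h
    · exact Or.inl h
    · right
      have : ‖((ContinuousLinearEquiv.refl ℝ E).symm : E →L[ℝ] E)‖₊ = 1 := by
        ext; simp
      rw [this]; simpa using NNReal.half_lt_self one_ne_zero
  let e : E ≃ₜ E := hap.toHomeomorph Φ hc
  have he : ⇑e = Φ := rfl
  have hanti : ∀ a b, ‖a - b‖ ≤ 2 * ‖Φ a - Φ b‖ := by
    intro a b
    have h1 := hn a b
    have h2 := norm_sub_norm_le (a - b) (Φ a - Φ b)
    rw [norm_sub_rev (a - b)] at h2
    linarith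
  have hD : ∀ a, ‖fderiv ℝ Φ a - ContinuousLinearMap.id ℝ E‖ ≤ 1 / 2 := by
    intro a
    have h1 : HasFDerivAt (fun x => Φ x - x) (fderiv ℝ Φ a - ContinuousLinearMap.id ℝ E) a :=
      (hΦ.diff a).hasFDerivAt.sub (hasFDerivAt_id a)
    have h2 : LipschitzWith (1 / 2) (fun x => Φ x - x) := by
      refine LipschitzWith.of_dist_le_mul fun x y => ?_
      rw [dist_eq_norm, dist_eq_norm]
      have := hn x y
      rw [sub_sub_sub_comm]
      simpa using this
    have := norm_fderiv_le_of_lipschitz ℝ h2 (x₀ := a)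
    rw [h1.fderiv] at this
    simpa using this
  have hinj : ∀ a, Function.Injective (fderiv ℝ Φ a : E →ₗ[ℝ] E) := by
    intro a
    rw [← LinearMap.ker_eq_bot, LinearMap.ker_eq_bot']
    intro v hv
    have h1 := (fderiv ℝ Φ a - ContinuousLinearMap.id ℝ E).le_of_opNorm_le (hD a) v
    have h2 : (fderiv ℝ Φ a) v = 0 := hv
    simp only [_root_.sub_apply, h2, ContinuousLinearMap.id_apply, zero_sub,
      norm_neg] at h1
    have := norm_nonneg v
    exact norm_eq_zero.1 (by linarith)
  let f' : E → E ≃L[ℝ] E := fun a =>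
    (LinearEquiv.ofInjectiveEndo _ (hinj a)).toContinuousLinearEquiv
  have hf' : ∀ a, HasFDerivAt e (f' a : E →L[ℝ] E) a := by
    intro a
    have : (f' a : E →L[ℝ] E) = fderiv ℝ Φ a := by ext v; rfl
    rw [this]
    exact (hΦ.diff a).hasFDerivAt
  have hcd : ContDiff ℝ 1 e.symm := e.contDiff_symm hf' hΦ.cd
  have h1 : ∀ y, Φ (e.symm y) = y := e.apply_symm_apply
  have h2 : ∀ x, e.symm (Φ x) = x := e.symm_apply_apply
  have hΨd : Differentiable ℝ e.symm := hcd.differentiable one_ne_zero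
  have hΨlip : ∀ a b, ‖e.symm a - e.symm b‖ ≤ 2 * ‖a - b‖ := by
    intro a b
    have := hanti (e.symm a) (e.symm b)
    rwa [h1, h1] at this
  have hbd : ∀ y, ‖fderiv ℝ e.symm y‖ ≤ 2 := by
    intro y
    have : LipschitzWith 2 e.symm := LipschitzWith.of_dist_le_mul fun a b => by
      rw [dist_eq_norm, dist_eq_norm]; exact hΨlip a b
    simpa using norm_fderiv_le_of_lipschitz ℝ this (x₀ := y)
  have hc1 : ∀ y, (fderiv ℝ Φ (e.symm y)).comp (fderiv ℝ e.symm y) =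
      ContinuousLinearMap.id ℝ E := by
    intro y
    rw [← fderiv_comp y (hΦ.diff _) (hΨd _)]
    have : Φ ∘ e.symm = id := funext h1
    rw [this, fderiv_id]
  have hc2 : ∀ y, (fderiv ℝ e.symm y).comp (fderiv ℝ Φ (e.symm y)) =
      ContinuousLinearMap.id ℝ E := by
    intro y
    have h3 : DifferentiableAt ℝ e.symm (Φ (e.symm y)) := hΨd _
    have := fderiv_comp (e.symm y) h3 (hΦ.diff _)
    rw [h1] at this
    rw [← this]
    have : e.symm ∘ Φ = id := funext h2
    rw [this, fderiv_id]
  refine ⟨e.symm, ⟨hcd, hbd, fun y z => ?_⟩, h1, h2⟩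
  have key : fderiv ℝ e.symm y - fderiv ℝ e.symm z = (fderiv ℝ e.symm y).comp
      ((fderiv ℝ Φ (e.symm z) - fderiv ℝ Φ (e.symm y)).comp (fderiv ℝ e.symm z)) := by
    rw [ContinuousLinearMap.sub_comp, hc1, ContinuousLinearMap.comp_sub,
      ← ContinuousLinearMap.comp_assoc, hc2]
    simp
  rw [key]
  have h5 : ‖e.symm z - e.symm y‖ ^ α ≤ 2 ^ α * ‖y - z‖ ^ α := by
    rw [← Real.mul_rpow (by norm_num) (norm_nonneg _)]
    refine Real.rpow_le_rpow (norm_nonneg _) ?_ hα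
    rw [norm_sub_rev]; exact hΨlip _ _
  have h6 : ‖fderiv ℝ Φ (e.symm z) - fderiv ℝ Φ (e.symm y)‖ ≤ C * (2 ^ α * ‖y - z‖ ^ α) :=
    (hΦ.ho _ _).trans (mul_le_mul_of_nonneg_left h5 hC)
  calc _ ≤ ‖fderiv ℝ e.symm y‖ *
        (‖fderiv ℝ Φ (e.symm z) - fderiv ℝ Φ (e.symm y)‖ * ‖fderiv ℝ e.symm z‖) :=
        (ContinuousLinearMap.opNorm_comp_le _ _).trans (mul_le_mul_of_nonneg_left
          (ContinuousLinearMap.opNorm_comp_le _ _) (norm_nonneg _))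
    _ ≤ 2 * ((C * (2 ^ α * ‖y - z‖ ^ α)) * 2) := by
        have h7 := hbd y
        have h8 := hbd z
        gcongr
    _ = _ := by ring

lemma exists_theta (V : Type*) [NormedAddCommGroup V] [InnerProductSpace ℝ V]
    [FiniteDimensional ℝ V] {α r : ℝ} (hα : 0 < α) (hα1 : α ≤ 1) (hr : 0 < r) :
    ∃ (θ : V → V) (K C : ℝ), Reg K C α θ ∧ 0 ≤ C ∧ (∀ x, ‖x‖ < r → θ x = x) ∧
      ∃ M, ∀ x, ‖θ x‖ ≤ M := by
  let χ : ContDiffBump (0 : V) := ⟨r, r + 1, hr, by linarith⟩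
  let θ : V → V := fun x => χ x • x
  have hcs : HasCompactSupport θ := χ.hasCompactSupport.smul_right
  have hcd : ContDiff ℝ 2 θ := (χ.contDiff).smul contDiff_id
  have hcd' : ContDiff ℝ 1 (fderiv ℝ θ) := hcd.fderiv_right (by norm_num)
  have hcs' : HasCompactSupport (fderiv ℝ θ) := hcs.fderiv ℝ
  obtain ⟨K, hK⟩ := hcs'.exists_bound_of_continuous hcd'.continuous
  obtain ⟨M, hM⟩ := hcs.exists_bound_of_continuous hcd.continuous
  obtain ⟨Λ, hΛ⟩ := hcd'.lipschitzWith_of_hasCompactSupport hcs' one_ne_zero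
  have hK0 : 0 ≤ K := (norm_nonneg _).trans (hK 0)
  refine ⟨θ, K, 2 * K + Λ, ⟨hcd.of_le (by norm_num), hK, fun ξ η => ?_⟩, by positivity, ?_, M, hM⟩
  · rcases le_total ‖ξ - η‖ 1 with h | h
    · have h1 := hΛ.dist_le_mul ξ η
      rw [dist_eq_norm, dist_eq_norm] at h1
      have h2 : ‖ξ - η‖ ≤ ‖ξ - η‖ ^ α := Real.self_le_rpow_of_le_one (norm_nonneg _) h hα1
      have h3 : (0:ℝ) ≤ Λ := Λ.2
      have : 0 ≤ ‖ξ - η‖ ^ α := by positivity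
      nlinarith
    · have h1 := norm_sub_le (fderiv ℝ θ ξ) (fderiv ℝ θ η)
      have h2 := hK ξ
      have h3 := hK η
      have h4 : 1 ≤ ‖ξ - η‖ ^ α := Real.one_le_rpow h hα.le
      have h5 : (0:ℝ) ≤ Λ := Λ.2
      nlinarith
  · intro x hx
    have : χ x = 1 := χ.one_of_mem_closedBall (by simpa [χ] using hx.le)
    simp [θ, this]

lemma close_lemma {K C α α' K' C' : ℝ} (hα : 0 < α') (hα' : α' < α) (hC : 0 ≤ C) (hC' : 0 ≤ C')
    {h : ℕ → F → G} {h₀ : F → G} (hh : ∀ j, Reg K C α (h j)) (hh₀ : Reg K C α h₀)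
    {S : Set F} (hu : TendstoUniformlyOn h h₀ atTop S)
    (hu' : TendstoUniformlyOn (fun j => fderiv ℝ (h j)) (fderiv ℝ h₀) atTop S)
    {Θ : E → F} (hΘ : Reg K' C' α Θ) (hS : ∀ x, Θ x ∈ S) (B : G →L[ℝ] H) (hB : ‖B‖ ≤ 1) (c : H)
    {ε : ℝ} (hε : 0 < ε) :
    ∃ J : ℕ, ∀ j, J ≤ j →
      (∀ ξ, ‖(B (h j (Θ ξ)) + c) - (B (h₀ (Θ ξ)) + c)‖ ≤ ε) ∧
      (∀ ξ, ‖fderiv ℝ (fun x => B (h j (Θ x)) + c) ξ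
        - fderiv ℝ (fun x => B (h₀ (Θ x)) + c) ξ‖ ≤ ε) ∧
      ∀ ξ η, ‖(fderiv ℝ (fun x => B (h j (Θ x)) + c) ξ
        - fderiv ℝ (fun x => B (h₀ (Θ x)) + c) ξ) - (fderiv ℝ (fun x => B (h j (Θ x)) + c) η
        - fderiv ℝ (fun x => B (h₀ (Θ x)) + c) η)‖ ≤ ε * ‖ξ - η‖ ^ α' := by
  have hα0 : 0 < α := hα.trans hα'
  have hK' := hΘ.K0
  have hK := hh₀.K0
  set C₂ := C * K' ^ α * K' + K * C' with hC₂
  have hC₂0 : 0 ≤ C₂ := by positivity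
  have hR : ∀ g : F → G, Reg K C α g → Reg (K * K') C₂ α (fun x => B (g (Θ x)) + c) := fun g hg =>
    (Reg.comp hα0.le hC hg hΘ).lcomp hα0.le hC₂0 B hB c
  have hd : ∀ g : F → G, Reg K C α g → ∀ ξ, fderiv ℝ (fun x => B (g (Θ x)) + c) ξ =
      B.comp ((fderiv ℝ g (Θ ξ)).comp (fderiv ℝ Θ ξ)) := by
    intro g hg ξ
    rw [fderiv_add_const]
    have h1 : HasFDerivAt (fun x => B (g (Θ x))) (B.comp ((fderiv ℝ g (Θ ξ)).comp (fderiv ℝ Θ ξ))) ξ :=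
      B.hasFDerivAt.comp ξ (((hg.diff _).hasFDerivAt).comp ξ (hΘ.diff ξ).hasFDerivAt)
    exact h1.fderiv
  obtain ⟨τ, hτ, hτ'⟩ : ∃ τ : ℝ, 0 < τ ∧ ∀ t, 0 ≤ t → t ≤ τ → 2 * C₂ * t ^ (α - α') ≤ ε := by
    have h1 : Tendsto (fun t : ℝ => 2 * C₂ * t ^ (α - α')) (𝓝 0) (𝓝 0) := by
      have := (Real.continuousAt_rpow_const 0 (α - α') (Or.inr (by linarith))).tendsto.const_mul
        (2 * C₂)
      simpa [Real.zero_rpow (sub_ne_zero.2 hα'.ne')] using this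
    obtain ⟨δ, hδ, h2⟩ := Metric.eventually_nhds_iff.1 (h1.eventually (gt_mem_nhds hε))
    refine ⟨δ / 2, by positivity, fun t ht0 ht => (h2 ?_).le⟩
    rw [Real.dist_eq, sub_zero, abs_of_nonneg ht0]; linarith
  set s := min ε (ε * τ ^ α' / 2) with hs
  have hs0 : 0 < s := lt_min hε (by positivity)
  have hsK : 0 < s / (K' + 1) := by positivity
  have e1 := (Metric.tendstoUniformlyOn_iff.1 hu) ε hε
  have e2 := (Metric.tendstoUniformlyOn_iff.1 hu') _ hsK
  obtain ⟨J, hJ⟩ := eventually_atTop.1 (e1.and e2)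
  refine ⟨J, fun j hj => ?_⟩
  obtain ⟨h1, h2⟩ := hJ j hj
  have hder : ∀ ξ, ‖fderiv ℝ (fun x => B (h j (Θ x)) + c) ξ
        - fderiv ℝ (fun x => B (h₀ (Θ x)) + c) ξ‖ ≤ s := by
    intro ξ
    rw [hd _ (hh j), hd _ hh₀, ← ContinuousLinearMap.comp_sub, ← ContinuousLinearMap.sub_comp]
    have h3 := (h2 _ (hS ξ)).le
    rw [dist_comm, dist_eq_norm] at h3
    calc _ ≤ ‖B‖ * (‖fderiv ℝ (h j) (Θ ξ) - fderiv ℝ h₀ (Θ ξ)‖ * ‖fderiv ℝ Θ ξ‖) :=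
          (ContinuousLinearMap.opNorm_comp_le _ _).trans (mul_le_mul_of_nonneg_left
          (ContinuousLinearMap.opNorm_comp_le _ _) (norm_nonneg _))
      _ ≤ 1 * (s / (K' + 1) * (K' + 1)) := by
          have := hΘ.bd ξ
          have : ‖fderiv ℝ Θ ξ‖ ≤ K' + 1 := by linarith
          gcongr
      _ = s := by field_simp
  refine ⟨fun ξ => ?_, fun ξ => (hder ξ).trans (min_le_left _ _), fun ξ η => ?_⟩
  · rw [add_sub_add_right_eq_sub, ← map_sub]
    refine (B.le_of_opNorm_le hB _).trans ?_
    rw [one_mul, ← dist_eq_norm, dist_comm]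
    exact (h1 _ (hS ξ)).le
  · rcases le_total ‖ξ - η‖ τ with ht | ht
    · have h3 := (hR _ (hh j)).ho ξ η
      have h4 := (hR _ hh₀).ho ξ η
      rw [sub_sub_sub_comm]
      refine (norm_sub_le _ _).trans ((add_le_add h3 h4).trans ?_)
      have h5 := hτ' _ (norm_nonneg _) ht
      rcases eq_or_lt_of_le (norm_nonneg (ξ - η)) with h0 | h0
      · rw [← h0, Real.zero_rpow hα0.ne', Real.zero_rpow hα.ne']; simp
      · have h6 : ‖ξ - η‖ ^ α = ‖ξ - η‖ ^ (α - α') * ‖ξ - η‖ ^ α' := by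
          rw [← Real.rpow_add h0]; ring_nf
        rw [h6]
        have h7 : 0 ≤ ‖ξ - η‖ ^ α' := by positivity
        nlinarith
    · have h3 := hder ξ
      have h4 := hder η
      have h5 : s ≤ ε * τ ^ α' / 2 := min_le_right _ _
      have h6 : τ ^ α' ≤ ‖ξ - η‖ ^ α' := Real.rpow_le_rpow hτ.le ht hα.le
      refine (norm_sub_le _ _).trans ?_
      nlinarith
end regs2

lemma Filter.Tendsto.clmap {E F : Type*} [NormedAddCommGroup E] [NormedSpace ℝ E]
    [NormedAddCommGroup F] [NormedSpace ℝ F] {u : ℕ → E →L[ℝ] F} {u₀ : E →L[ℝ] F} {a : ℕ → E}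
    {a₀ : E} (hu : Tendsto u atTop (𝓝 u₀)) (ha : Tendsto a atTop (𝓝 a₀)) :
    Tendsto (fun j => u j (a j)) atTop (𝓝 (u₀ a₀)) :=
  ((isBoundedBilinearMap_apply (𝕜 := ℝ) (E := E) (F := F)).continuous.tendsto (u₀, a₀)).comp
    (hu.prodMk_nhds ha)

set_option linter.unusedSectionVars false
section frames
variable {V W E : Type*} [NormedAddCommGroup V] [InnerProductSpace ℝ V] [FiniteDimensional ℝ V]
  [NormedAddCommGroup W] [InnerProductSpace ℝ W] [FiniteDimensional ℝ W]
  [NormedAddCommGroup E] [InnerProductSpace ℝ E] [FiniteDimensional ℝ E]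
  [CompleteSpace V] [CompleteSpace W] [CompleteSpace E]

structure Fr (u : V →L[ℝ] E) (w : W →L[ℝ] E) : Prop where
  uu : ∀ v, u.adjoint (u v) = v
  ww : ∀ v, w.adjoint (w v) = v
  uw : ∀ v, u.adjoint (w v) = 0
  wu : ∀ v, w.adjoint (u v) = 0
  sum : ∀ z, u (u.adjoint z) + w (w.adjoint z) = z

lemma norm_le_one_of_uu {u : V →L[ℝ] E} (h : ∀ v, u.adjoint (u v) = v) : ‖u‖ ≤ 1 := by
  refine u.opNorm_le_bound zero_le_one fun v => ?_
  have h1 : ‖u v‖ ^ 2 = ‖v‖ ^ 2 := by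
    rw [← real_inner_self_eq_norm_sq, ← real_inner_self_eq_norm_sq,
      ← ContinuousLinearMap.adjoint_inner_right, h]
  rw [one_mul]
  exact (pow_le_pow_iff_left₀ (norm_nonneg _) (norm_nonneg _) two_ne_zero).1 h1.le

lemma Fr.nu {u : V →L[ℝ] E} {w : W →L[ℝ] E} (h : Fr u w) : ‖u‖ ≤ 1 := norm_le_one_of_uu h.uu
lemma Fr.nw {u : V →L[ℝ] E} {w : W →L[ℝ] E} (h : Fr u w) : ‖w‖ ≤ 1 := norm_le_one_of_uu h.ww
lemma Fr.nua {u : V →L[ℝ] E} {w : W →L[ℝ] E} (h : Fr u w) : ‖u.adjoint‖ ≤ 1 := by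
  rw [LinearIsometryEquiv.norm_map]; exact h.nu
lemma Fr.nwa {u : V →L[ℝ] E} {w : W →L[ℝ] E} (h : Fr u w) : ‖w.adjoint‖ ≤ 1 := by
  rw [LinearIsometryEquiv.norm_map]; exact h.nw

lemma adj_tendsto {u : ℕ → V →L[ℝ] E} {u₀ : V →L[ℝ] E}
    (hu : Tendsto u atTop (𝓝 u₀)) :
    Tendsto (fun j => (u j).adjoint) atTop (𝓝 u₀.adjoint) :=
  ((ContinuousLinearMap.adjoint (𝕜 := ℝ) (E := V) (F := E)).continuous.tendsto u₀).comp hu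

lemma Fr.lim {u : ℕ → V →L[ℝ] E} {w : ℕ → W →L[ℝ] E} {u₀ : V →L[ℝ] E} {w₀ : W →L[ℝ] E}
    (h : ∀ j, Fr (u j) (w j)) (hu : Tendsto u atTop (𝓝 u₀)) (hw : Tendsto w atTop (𝓝 w₀)) :
    Fr u₀ w₀ := by
  have hu' := adj_tendsto hu
  have hw' := adj_tendsto hw
  have cu : ∀ v, Tendsto (fun j => u j v) atTop (𝓝 (u₀ v)) := fun v => hu.clmap tendsto_const_nhds
  have cw : ∀ v, Tendsto (fun j => w j v) atTop (𝓝 (w₀ v)) := fun v => hw.clmap tendsto_const_nhds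
  refine ⟨fun v => ?_, fun v => ?_, fun v => ?_, fun v => ?_, fun z => ?_⟩
  · refine tendsto_nhds_unique (hu'.clmap (cu v)) ?_
    simp only [(h _).uu]; exact tendsto_const_nhds
  · refine tendsto_nhds_unique (hw'.clmap (cw v)) ?_
    simp only [(h _).ww]; exact tendsto_const_nhds
  · refine tendsto_nhds_unique (hu'.clmap (cw v)) ?_
    simp only [(h _).uw]; exact tendsto_const_nhds
  · refine tendsto_nhds_unique (hw'.clmap (cu v)) ?_
    simp only [(h _).wu]; exact tendsto_const_nhds
  · refine tendsto_nhds_unique ((hu.clmap (hu'.clmap tendsto_const_nhds)).add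
      (hw.clmap (hw'.clmap tendsto_const_nhds))) ?_
    simp only [(h _).sum]; exact tendsto_const_nhds

lemma tilt {u u' : V →L[ℝ] E} {w w' : W →L[ℝ] E} (h : Fr u w) (h' : Fr u' w')
    (hu : ‖u' - u‖ ≤ 1 / 4) (hw : ‖w' - w‖ ≤ 1 / 4) {L α : ℝ} (hL : 0 ≤ L) (hα : 0 ≤ α)
    {g : V → W} (hg : Reg 1 L α g) (hg0 : g 0 = 0) (x x' : E) :
    ∃ k : V → W, Reg 4 (L * 2 ^ α * 2 + 2 * (4 * L * 2 ^ α)) α k ∧ ‖k 0‖ ≤ 5 * ‖x' - x‖ ∧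
      (range fun ξ => x' + u' ξ + w' (g ξ)) = range fun η => x + u η + w (k η) := by
  set z := x' - x with hz
  let G : V → E := fun ξ => u' ξ + w' (g ξ)
  have hG : Reg 2 L α G := by
    have h1 := (Reg.clm (α := α) u' 0).mono h'.nu le_rfl
    have h2 := hg.lcomp hα hL w' h'.nw 0
    have h3 := h1.add h2
    simp only [add_zero, zero_add] at h3
    refine h3.mono (by norm_num) le_rfl
  let Φ : V → V := fun ξ => u.adjoint (G ξ) + u.adjoint z
  have hΦ : Reg 2 L α Φ := hG.lcomp hα hL _ h.nua _
  have hn : ∀ a b, ‖Φ a - Φ b - (a - b)‖ ≤ 1 / 2 * ‖a - b‖ := by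
    intro a b
    have e : Φ a - Φ b - (a - b) =
        u.adjoint ((u' - u) (a - b) + (w' - w) (g a - g b)) := by
      simp only [Φ, G, map_add, map_sub, _root_.sub_apply, h.uu, h.uw]
      abel
    rw [e]
    refine (u.adjoint.le_of_opNorm_le h.nua _).trans ?_
    have h1 := (u' - u).le_of_opNorm_le hu (a - b)
    have h2 := (w' - w).le_of_opNorm_le hw (g a - g b)
    have h3 := hg.lip a b
    have h4 := norm_add_le ((u' - u) (a - b)) ((w' - w) (g a - g b))
    linarith
  obtain ⟨Ψ, hΨ, h1, h2⟩ := hΦ.inv hα hL hn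
  let k : V → W := fun η => w.adjoint (G (Ψ η)) + w.adjoint z
  have hk : Reg 4 (L * 2 ^ α * 2 + 2 * (4 * L * 2 ^ α)) α k := by
    have h3 := (hG.comp hα hL hΨ).lcomp hα (by positivity) w.adjoint h.nwa (w.adjoint z)
    exact h3.mono (by norm_num) le_rfl
  have key : ∀ ξ, x' + u' ξ + w' (g ξ) = x + u (Φ ξ) + w (k (Φ ξ)) := by
    intro ξ
    simp only [k, h2]
    have h3 := h.sum (G ξ)
    have h4 := h.sum z
    have h5 : x' + u' ξ + w' (g ξ) = x + (G ξ + z) := by simp only [G, hz]; abel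
    rw [h5]
    nth_rewrite 1 [← h3]
    nth_rewrite 1 [← h4]
    simp only [Φ, map_add]
    abel
  refine ⟨k, hk, ?_, ?_⟩
  · have h3 : Φ 0 = u.adjoint z := by simp [Φ, G, hg0]
    have h4 : k (u.adjoint z) = w.adjoint z := by
      rw [← h3]; simp only [k, h2]; simp [G, hg0]
    have h5 := hk.lip 0 (u.adjoint z)
    rw [h4, zero_sub, norm_neg] at h5
    have h6 := u.adjoint.le_of_opNorm_le h.nua z
    have h7 := w.adjoint.le_of_opNorm_le h.nwa z
    have h8 := norm_le_norm_sub_add (k 0) (w.adjoint z)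
    linarith
  · ext y
    constructor
    · rintro ⟨ξ, rfl⟩
      exact ⟨Φ ξ, (key ξ).symm⟩
    · rintro ⟨η, rfl⟩
      refine ⟨Ψ η, ?_⟩
      have := key (Ψ η)
      rw [h1] at this
      exact this

lemma Fr.solve {u : V →L[ℝ] E} {w : W →L[ℝ] E} (h : Fr u w) {x y : E} {ξ : V} {v : W}
    (hy : x + u ξ + w v = y) : u.adjoint (y - x) = ξ := by
  rw [← hy]
  have : x + u ξ + w v - x = u ξ + w v := by abel
  rw [this, map_add, h.uu, h.uw, add_zero]

lemma graph_limit {Ss : ℕ → Set E} {S₀ : Set E}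
    (c1 : ∀ y ∈ S₀, ∃ s : ℕ → E, (∀ j, s j ∈ Ss j) ∧ Tendsto s atTop (𝓝 y))
    (c2 : ∀ (s : ℕ → E) (y : E), (∀ᶠ j in atTop, s j ∈ Ss j) → Tendsto s atTop (𝓝 y) → y ∈ S₀)
    {u : ℕ → V →L[ℝ] E} {w : ℕ → W →L[ℝ] E} {u₀ : V →L[ℝ] E} {w₀ : W →L[ℝ] E}
    (h : ∀ j, Fr (u j) (w j)) (hu : Tendsto u atTop (𝓝 u₀)) (hw : Tendsto w atTop (𝓝 w₀))
    {x : ℕ → E} {x₀ : E} (hx : Tendsto x atTop (𝓝 x₀)) {g : ℕ → V → W} {g₀ : V → W} {K : ℝ}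
    (hlip : ∀ j a b, ‖g j a - g j b‖ ≤ K * ‖a - b‖)
    (hg : ∀ a, Tendsto (fun j => g j a) atTop (𝓝 (g₀ a))) {r : ℝ}
    (hp : ∀ j, Ss j ∩ ball (x j) r = (range fun ξ => x j + u j ξ + w j (g j ξ)) ∩ ball (x j) r) :
    S₀ ∩ ball x₀ r = (range fun ξ => x₀ + u₀ ξ + w₀ (g₀ ξ)) ∩ ball x₀ r := by
  have hball : ∀ (s : ℕ → E) (y : E), y ∈ ball x₀ r → Tendsto s atTop (𝓝 y) →
      ∀ᶠ j in atTop, s j ∈ ball (x j) r := by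
    intro s y hy hs
    have h1 : Tendsto (fun j => dist (s j) (x j)) atTop (𝓝 (dist y x₀)) := hs.dist hx
    exact h1.eventually (gt_mem_nhds hy)
  ext y
  constructor
  · rintro ⟨hy, hyb⟩
    refine ⟨?_, hyb⟩
    obtain ⟨s, hs, hsy⟩ := c1 y hy
    have hua := adj_tendsto hu
    have hξ : Tendsto (fun j => (u j).adjoint (s j - x j)) atTop (𝓝 (u₀.adjoint (y - x₀))) :=
      hua.clmap (hsy.sub hx)
    set ξ₀ := u₀.adjoint (y - x₀)
    have hgξ : Tendsto (fun j => g j ((u j).adjoint (s j - x j))) atTop (𝓝 (g₀ ξ₀)) := by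
      have h1 : Tendsto (fun j => g j ((u j).adjoint (s j - x j)) - g j ξ₀) atTop (𝓝 0) := by
        refine squeeze_zero_norm (fun j => hlip j _ _) ?_
        have h2 : Tendsto (fun j => (u j).adjoint (s j - x j) - ξ₀) atTop (𝓝 0) := by
          simpa using hξ.sub (tendsto_const_nhds (x := ξ₀))
        simpa using h2.norm.const_mul K
      simpa using h1.add (hg ξ₀)
    refine ⟨ξ₀, ?_⟩
    have hlim := (hx.add (hu.clmap hξ)).add (hw.clmap hgξ)
    refine tendsto_nhds_unique hlim (hsy.congr' ?_)
    filter_upwards [hball s y hyb hsy] with j hj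
    have h3 : s j ∈ Ss j ∩ ball (x j) r := ⟨hs j, hj⟩
    rw [hp] at h3
    obtain ⟨⟨ξ, hξe⟩, -⟩ := h3
    have h4 := (h j).solve hξe
    rw [h4]
    exact hξe.symm
  · rintro ⟨⟨ξ, rfl⟩, hyb⟩
    refine ⟨?_, hyb⟩
    have hlim : Tendsto (fun j => x j + u j ξ + w j (g j ξ)) atTop
        (𝓝 (x₀ + u₀ ξ + w₀ (g₀ ξ))) :=
      (hx.add (hu.clmap tendsto_const_nhds)).add (hw.clmap (hg ξ))
    refine c2 _ _ ?_ hlim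
    filter_upwards [hball _ _ hyb hlim] with j hj
    have h3 : x j + u j ξ + w j (g j ξ) ∈ Ss j ∩ ball (x j) r := by
      rw [hp]; exact ⟨⟨ξ, rfl⟩, hj⟩
    exact h3.1

lemma patch_shift {u : V →L[ℝ] E} {w : W →L[ℝ] E} (h : Fr u w) {S : Set E} {x₀ x : E} {r : ℝ}
    {k : V → W} (hp : S ∩ ball x₀ (2 * r) = (range fun ξ => x₀ + u ξ + w (k ξ)) ∩ ball x₀ (2 * r))
    (hx : dist x x₀ < r) {θ : V → V} (hθ : ∀ v, ‖v‖ < r → θ v = v) :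
    S ∩ ball x r = (range fun v => x + u v +
      w (k (θ v + u.adjoint (x - x₀)) - w.adjoint (x - x₀))) ∩ ball x r := by
  have hsub : ∀ y ∈ ball x r, y ∈ ball x₀ (2 * r) := by
    intro y hy
    rw [mem_ball] at *
    linarith [dist_triangle y x x₀]
  have hS : ∀ y ∈ ball x r, (y ∈ S ↔ ∃ ξ, x₀ + u ξ + w (k ξ) = y) := by
    intro y hy
    have h1 : y ∈ S ∩ ball x₀ (2 * r) ↔ y ∈ (range fun ξ => x₀ + u ξ + w (k ξ)) ∩ ball x₀ (2 * r) := by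
      rw [hp]
    simpa [hsub y hy] using h1
  have e : ∀ v, x + u v + w (k (v + u.adjoint (x - x₀)) - w.adjoint (x - x₀)) =
      x₀ + u (v + u.adjoint (x - x₀)) + w (k (v + u.adjoint (x - x₀))) := by
    intro v
    have h1 := h.sum (x - x₀)
    rw [map_sub, map_add u]
    have h2 : w (w.adjoint (x - x₀)) = (x - x₀) - u (u.adjoint (x - x₀)) := by
      rw [eq_sub_iff_add_eq, add_comm]; exact h1
    rw [h2]; abel
  have hsmall : ∀ (v : V) (a : W), x + u v + w a ∈ ball x r → ‖v‖ < r := by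
    intro v a hb
    have h1 := h.solve (rfl : x + u v + w a = _)
    rw [← h1]
    refine (u.adjoint.le_of_opNorm_le h.nua _).trans_lt ?_
    rw [one_mul, ← dist_eq_norm]; exact hb
  ext y
  constructor
  · rintro ⟨hy, hb⟩
    refine ⟨?_, hb⟩
    obtain ⟨ξ, hξ⟩ := (hS y hb).1 hy
    refine ⟨ξ - u.adjoint (x - x₀), ?_⟩
    have e1 := e (ξ - u.adjoint (x - x₀))
    rw [sub_add_cancel, hξ] at e1
    have h2 := hsmall _ _ (e1 ▸ hb)
    simp only [hθ _ h2, sub_add_cancel]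
    exact e1
  · rintro ⟨⟨v, hv⟩, hb⟩
    refine ⟨?_, hb⟩
    rw [hS y hb]
    have h2 := hsmall _ _ (by simp only at hv; rw [hv]; exact hb)
    simp only [hθ _ h2] at hv
    rw [e] at hv
    exact ⟨_, hv⟩

/-- projection data -/
lemma Fr.back {u : V →L[ℝ] E} {w : W →L[ℝ] E} (h : Fr u w) :
    ∃ T : Submodule ℝ E, Module.finrank ℝ T = Module.finrank ℝ V ∧
      ∃ (p : T →L[ℝ] V) (q : W →L[ℝ] Tᗮ), ‖p‖ ≤ 1 ∧ ‖q‖ ≤ 1 ∧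
        ∀ (g : V → W) (x : E), (range fun v => x + u v + w (g v)) =
          range fun t : T => x + (t : E) + (q (g (p t)) : E) := by
  let T : Submodule ℝ E := LinearMap.range (u : V →ₗ[ℝ] E)
  have hinj : Function.Injective (u : V →ₗ[ℝ] E) := by
    intro a b hab
    have : u a = u b := hab
    rw [← h.uu a, ← h.uu b, this]
  have hw : ∀ y, w y ∈ Tᗮ := by
    intro y
    rw [Submodule.mem_orthogonal]
    rintro _ ⟨v, rfl⟩
    show inner ℝ (u v) (w y) = 0
    rw [← ContinuousLinearMap.adjoint_inner_right, h.uw, inner_zero_right]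
  refine ⟨T, LinearMap.finrank_range_of_inj hinj, u.adjoint.comp T.subtypeL,
    w.codRestrict Tᗮ hw, ?_, ?_, ?_⟩
  · refine ContinuousLinearMap.opNorm_le_bound _ zero_le_one fun t => ?_
    exact u.adjoint.le_of_opNorm_le h.nua t
  · refine ContinuousLinearMap.opNorm_le_bound _ zero_le_one fun t => ?_
    exact w.le_of_opNorm_le h.nw t
  · intro g x
    ext y
    constructor
    · rintro ⟨v, rfl⟩
      refine ⟨⟨u v, ⟨v, rfl⟩⟩, ?_⟩
      simp [h.uu]
    · rintro ⟨⟨_, ⟨v, rfl⟩⟩, rfl⟩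
      refine ⟨v, ?_⟩
      simp [h.uu]
end frames

lemma hconv1 {E : Type*} [MetricSpace E] {Ss : ℕ → Set E} {S₀ : Set E}
    (hn : ∀ j, (Ss j).Nonempty) (hc : ∀ j, IsCompact (Ss j)) (hn₀ : S₀.Nonempty)
    (hc₀ : IsCompact S₀) (h : Tendsto (fun j => hausdorffDist (Ss j) S₀) atTop (𝓝 0)) :
    ∀ y ∈ S₀, ∃ s : ℕ → E, (∀ j, s j ∈ Ss j) ∧ Tendsto s atTop (𝓝 y) := by
  intro y hy
  choose s hs hsd using fun j => (hc j).exists_infDist_eq_dist (hn j) y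
  refine ⟨s, hs, ?_⟩
  rw [tendsto_iff_dist_tendsto_zero]
  refine squeeze_zero (fun _ => dist_nonneg) (fun j => ?_) h
  rw [dist_comm, ← hsd, hausdorffDist_comm]
  exact infDist_le_hausdorffDist_of_mem hy (hausdorffEDist_ne_top_of_nonempty_of_bounded hn₀ (hn j)
    hc₀.isBounded (hc j).isBounded)

lemma hconv2 {E : Type*} [MetricSpace E] {Ss : ℕ → Set E} {S₀ : Set E}
    (hn : ∀ j, (Ss j).Nonempty) (hc : ∀ j, IsCompact (Ss j)) (hn₀ : S₀.Nonempty)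
    (hc₀ : IsCompact S₀) (h : Tendsto (fun j => hausdorffDist (Ss j) S₀) atTop (𝓝 0)) :
    ∀ (s : ℕ → E) (y : E), (∀ᶠ j in atTop, s j ∈ Ss j) → Tendsto s atTop (𝓝 y) → y ∈ S₀ := by
  intro s y hs hy
  rw [hc₀.isClosed.mem_iff_infDist_zero hn₀]
  have h1 : Tendsto (fun j => infDist (s j) S₀) atTop (𝓝 (infDist y S₀)) :=
    ((continuous_infDist_pt S₀).tendsto y).comp hy
  refine tendsto_nhds_unique h1 ?_
  refine squeeze_zero' (Eventually.of_forall fun _ => infDist_nonneg) ?_ h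
  filter_upwards [hs] with j hj
  exact infDist_le_hausdorffDist_of_mem hj (hausdorffEDist_ne_top_of_nonempty_of_bounded (hn j) hn₀
    (hc j).isBounded hc₀.isBounded)

abbrev ES (n : ℕ) := EuclideanSpace ℝ (Fin n)

lemma extract {m n : ℕ} {R L α : ℝ} (hL : 0 ≤ L) (hα : 0 ≤ α)
    {S : Set (ES n)} {x : ES n} {T : Submodule ℝ (ES n)}
    (h : IsGraphPatchAt m n R L α S x T) :
    ∃ (u : ES m →L[ℝ] ES n) (w : ES (n - m) →L[ℝ] ES n) (g : ES m → ES (n - m)),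
      Fr u w ∧ Reg 1 L α g ∧ g 0 = 0 ∧ fderiv ℝ g 0 = 0 ∧
      S ∩ ball x R = (range fun ξ => x + u ξ + w (g ξ)) ∩ ball x R := by
  obtain ⟨hT, f, hf, hf0, hfd, hlip, hho, hS⟩ := h
  have hT' : Module.finrank ℝ Tᗮ = n - m := by
    have h1 := T.finrank_add_finrank_orthogonal
    rw [hT, finrank_euclideanSpace_fin] at h1
    exact Nat.eq_sub_of_add_eq' h1
  let e : ES m ≃ₗᵢ[ℝ] T := ((stdOrthonormalBasis ℝ T).reindex (finCongr hT)).repr.symm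
  let e' : ES (n - m) ≃ₗᵢ[ℝ] Tᗮ := ((stdOrthonormalBasis ℝ Tᗮ).reindex (finCongr hT')).repr.symm
  let eL : ES m →L[ℝ] T := e.toContinuousLinearEquiv
  let eL' : ES (n - m) →L[ℝ] Tᗮ := e'.toContinuousLinearEquiv
  let fL : Tᗮ →L[ℝ] ES (n - m) := e'.symm.toContinuousLinearEquiv
  have heL : ‖eL‖ ≤ 1 := ContinuousLinearMap.opNorm_le_bound _ zero_le_one fun v => by
    rw [one_mul]; exact (e.norm_map v).le
  have hfL : ‖fL‖ ≤ 1 := ContinuousLinearMap.opNorm_le_bound _ zero_le_one fun v => by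
    rw [one_mul]; exact (e'.symm.norm_map v).le
  let u : ES m →L[ℝ] ES n := T.subtypeL.comp eL
  let w : ES (n - m) →L[ℝ] ES n := Tᗮ.subtypeL.comp eL'
  have hua : ∀ v, u v = (e v : ES n) := fun _ => rfl
  have hwa : ∀ v, w v = (e' v : ES n) := fun _ => rfl
  have huu : ∀ v, u.adjoint (u v) = v := fun v => ext_inner_left ℝ fun a => by
    rw [ContinuousLinearMap.adjoint_inner_right, hua, hua, ← Submodule.coe_inner, e.inner_map_map]
  have hww : ∀ v, w.adjoint (w v) = v := fun v => ext_inner_left ℝ fun a => by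
    rw [ContinuousLinearMap.adjoint_inner_right, hwa, hwa, ← Submodule.coe_inner, e'.inner_map_map]
  have huw : ∀ v, u.adjoint (w v) = 0 := fun v => ext_inner_left ℝ fun a => by
    rw [ContinuousLinearMap.adjoint_inner_right, hua, hwa, inner_zero_right]
    exact Submodule.inner_right_of_mem_orthogonal (e a).2 (e' v).2
  have hwu : ∀ v, w.adjoint (u v) = 0 := fun v => ext_inner_left ℝ fun a => by
    rw [ContinuousLinearMap.adjoint_inner_right, hua, hwa, inner_zero_right]
    exact Submodule.inner_left_of_mem_orthogonal (e v).2 (e' a).2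
  have hfr : Fr u w := by
    refine ⟨huu, hww, huw, hwu, fun z => ?_⟩
    obtain ⟨a, ha, b, hb, rfl⟩ := T.exists_add_mem_mem_orthogonal z
    have h1 : a = u (e.symm ⟨a, ha⟩) := by rw [hua]; simp
    have h2 : b = w (e'.symm ⟨b, hb⟩) := by rw [hwa]; simp
    generalize e.symm ⟨a, ha⟩ = a' at h1
    generalize e'.symm ⟨b, hb⟩ = b' at h2
    subst h1 h2
    simp [huu, huw, hww, hwu]
  have hfreg : Reg 1 L α f := ⟨hf, fun ξ => by
    simpa using norm_fderiv_le_of_lipschitz ℝ hlip (x₀ := ξ), hho⟩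
  let g : ES m → ES (n - m) := fun v => fL (f (eL v + 0)) + 0
  have hg : Reg 1 L α g := (hfreg.rcomp hα hL eL heL 0).lcomp hα hL fL hfL 0
  have hgv : ∀ v, g v = e'.symm (f (e v)) := fun v => by
    simp only [g, add_zero]; rfl
  refine ⟨u, w, g, hfr, hg, ?_, ?_, ?_⟩
  · rw [hgv, map_zero, hf0, map_zero]
  · have hgf : g = fun v => fL (f (eL v)) := by simp only [g, add_zero]
    have h1 : HasFDerivAt f (0 : T →L[ℝ] Tᗮ) (eL 0) := by
      have h2 := (hfreg.diff 0).hasFDerivAt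
      rw [hfd] at h2
      rwa [map_zero]
    have h3 : HasFDerivAt g (fL.comp ((0 : T →L[ℝ] Tᗮ).comp eL)) 0 := by
      rw [hgf]
      exact fL.hasFDerivAt.comp 0 (h1.comp 0 eL.hasFDerivAt)
    rw [h3.fderiv]; simp
  · rw [hS]
    congr 1
    have : (fun ξ => x + u ξ + w (g ξ)) = (fun ξ : T => x + (ξ : ES n) + (f ξ : ES n)) ∘ e := by
      funext v
      simp only [hua, hwa, hgv, Function.comp, LinearIsometryEquiv.apply_symm_apply]
    rw [this, e.surjective.range_comp]

lemma clm_subseq {E F : Type*} [NormedAddCommGroup E] [NormedSpace ℝ E] [FiniteDimensional ℝ E]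
    [NormedAddCommGroup F] [NormedSpace ℝ F] [FiniteDimensional ℝ F] (u : ℕ → E →L[ℝ] F)
    (hu : ∀ j, ‖u j‖ ≤ 1) : ∃ φ : ℕ → ℕ, StrictMono φ ∧ ∃ u₀, Tendsto (u ∘ φ) atTop (𝓝 u₀) := by
  have := FiniteDimensional.proper ℝ (E →L[ℝ] F)
  obtain ⟨u₀, -, φ, hφ, h⟩ := (isCompact_closedBall (0 : E →L[ℝ] F) 1).tendsto_subseq (x := u)
    (fun j => by simpa using hu j)
  exact ⟨φ, hφ, u₀, h⟩

/-- common setup: subsequence with converging centers and frames -/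
lemma setup {m n : ℕ} {R L d α : ℝ} (hL : 0 ≤ L) (hα : 0 ≤ α) {Ss : ℕ → Set (ES n)}
    {S₀ : Set (ES n)} (hSs : ∀ j, InClassC1 m n R L d α (Ss j)) (hn₀ : S₀.Nonempty)
    (hc₀ : IsCompact S₀) (h : Tendsto (fun j => hausdorffDist (Ss j) S₀) atTop (𝓝 0))
    {x : ES n} (hx : x ∈ S₀) :
    ∃ φ : ℕ → ℕ, StrictMono φ ∧ ∃ (y : ℕ → ES n) (u : ℕ → ES m →L[ℝ] ES n)
      (w : ℕ → ES (n - m) →L[ℝ] ES n) (g : ℕ → ES m → ES (n - m)) (u₀ : ES m →L[ℝ] ES n)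
      (w₀ : ES (n - m) →L[ℝ] ES n), Tendsto y atTop (𝓝 x) ∧ Tendsto u atTop (𝓝 u₀) ∧
      Tendsto w atTop (𝓝 w₀) ∧ Fr u₀ w₀ ∧ ∀ j, Fr (u j) (w j) ∧ Reg 1 L α (g j) ∧ g j 0 = 0 ∧
        fderiv ℝ (g j) 0 = 0 ∧
        Ss (φ j) ∩ ball (y j) R = (range fun ξ => y j + u j ξ + w j (g j ξ)) ∩ ball (y j) R := by
  obtain ⟨y, hy, hyx⟩ := hconv1 (fun j => (hSs j).1) (fun j => (hSs j).2.1) hn₀ hc₀ h x hx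
  choose T hT using fun j => (hSs j).2.2.2 (y j) (hy j)
  choose u w g hfr hg hg0 hgd hp using fun j => extract hL hα (hT j)
  obtain ⟨φ, hφ, u₀, hu⟩ := clm_subseq u (fun j => (hfr j).nu)
  obtain ⟨ψ, hψ, w₀, hw⟩ := clm_subseq (w ∘ φ) (fun j => (hfr (φ j)).nw)
  have hu' : Tendsto (fun j => u (φ (ψ j))) atTop (𝓝 u₀) := hu.comp hψ.tendsto_atTop
  have hw' : Tendsto (fun j => w (φ (ψ j))) atTop (𝓝 w₀) := hw
  exact ⟨φ ∘ ψ, hφ.comp hψ, fun j => y (φ (ψ j)), fun j => u (φ (ψ j)), fun j => w (φ (ψ j)),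
    fun j => g (φ (ψ j)), u₀, w₀, hyx.comp (hφ.comp hψ).tendsto_atTop, hu', hw',
    Fr.lim (fun j => hfr _) hu' hw', fun j => ⟨hfr _, hg _, hg0 _, hgd _, hp _⟩⟩

lemma limit_mem {m n : ℕ} {R L d α : ℝ} (hL : 0 ≤ L) (hα : 0 < α) {Ss : ℕ → Set (ES n)}
    {S₀ : Set (ES n)} (hSs : ∀ j, InClassC1 m n R L d α (Ss j)) (hn₀ : S₀.Nonempty)
    (hc₀ : IsCompact S₀) (hd : S₀ ⊆ closedBall 0 d)
    (h : Tendsto (fun j => hausdorffDist (Ss j) S₀) atTop (𝓝 0)) :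
    InClassC1 m n R L d α S₀ := by
  refine ⟨hn₀, hc₀, hd, fun x hx => ?_⟩
  obtain ⟨φ, hφ, y, u, w, g, u₀, w₀, hy, hu, hw, hfr, hall⟩ := setup hL hα.le hSs hn₀ hc₀ h hx
  obtain ⟨ψ, hψ, g₀, hg₀, hgu, hgu'⟩ := aa1 hα g (fun j => (hall j).2.1) (M := 0)
    (fun j => by rw [(hall j).2.2.1, norm_zero])
  have hgp : ∀ a, Tendsto (fun j => g (ψ j) a) atTop (𝓝 (g₀ a)) := fun a =>
    (hgu {a} isCompact_singleton).tendsto_at rfl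
  have hgp' : ∀ a, Tendsto (fun j => fderiv ℝ (g (ψ j)) a) atTop (𝓝 (fderiv ℝ g₀ a)) := fun a =>
    (hgu' {a} isCompact_singleton).tendsto_at rfl
  have hφψ := (hφ.comp hψ).tendsto_atTop
  have h' : Tendsto (fun j => hausdorffDist (Ss (φ (ψ j))) S₀) atTop (𝓝 0) := h.comp hφψ
  have hlim := graph_limit (Ss := fun j => Ss (φ (ψ j)))
    (hconv1 (fun j => (hSs _).1) (fun j => (hSs _).2.1) hn₀ hc₀ h')
    (hconv2 (fun j => (hSs _).1) (fun j => (hSs _).2.1) hn₀ hc₀ h')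
    (fun j => (hall (ψ j)).1) (hu.comp hψ.tendsto_atTop) (hw.comp hψ.tendsto_atTop)
    (hy.comp hψ.tendsto_atTop) (fun j a b => (hall (ψ j)).2.1.lip a b) hgp
    (fun j => (hall (ψ j)).2.2.2.2)
  have hg00 : g₀ 0 = 0 := tendsto_nhds_unique (hgp 0) (by
    simp only [(hall _).2.2.1]; exact tendsto_const_nhds)
  have hgd0 : fderiv ℝ g₀ 0 = 0 := tendsto_nhds_unique (hgp' 0) (by
    simp only [(hall _).2.2.2.1]; exact tendsto_const_nhds)
  obtain ⟨T, hT, p, q, hp, hq, hrange⟩ := hfr.back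
  refine ⟨T, by rw [hT]; simp, fun t => q (g₀ (p t)), ?_⟩
  have hreg : Reg 1 L α (fun t => q (g₀ (p t))) := by
    simpa using (hg₀.rcomp hα.le hL p hp 0).lcomp hα.le hL q hq 0
  refine ⟨hreg.cd, ?_, ?_, ?_, hreg.ho, ?_⟩
  · simp [hg00]
  · have h1 : HasFDerivAt g₀ (0 : ES m →L[ℝ] ES (n - m)) (p 0) := by
      have h2 := (hg₀.diff 0).hasFDerivAt
      rw [hgd0] at h2
      rwa [map_zero]
    have h3 : HasFDerivAt (fun t => q (g₀ (p t)))
        (q.comp ((0 : ES m →L[ℝ] ES (n - m)).comp p)) 0 :=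
      q.hasFDerivAt.comp 0 (h1.comp 0 p.hasFDerivAt)
    rw [h3.fderiv]; simp
  · refine LipschitzWith.of_dist_le_mul fun a b => ?_
    rw [dist_eq_norm, dist_eq_norm]
    exact hreg.lip a b
  · rw [hlim, hrange]

def Good (m n : ℕ) (R α : ℝ) (Ss : ℕ → Set (ES n)) (S₀ : Set (ES n)) (x : ES n) : Prop :=
  ∃ (u : ES m →L[ℝ] ES n) (w : ES (n - m) →L[ℝ] ES n) (K C : ℝ)
    (k : ℕ → ES m → ES (n - m)) (k₀ : ES m → ES (n - m)), Fr u w ∧ 0 ≤ C ∧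
    (∀ j, Reg K C α (k j)) ∧ Reg K C α k₀ ∧
    (∀ S, IsCompact S → TendstoUniformlyOn k k₀ atTop S) ∧
    (∀ S, IsCompact S → TendstoUniformlyOn (fun j => fderiv ℝ (k j)) (fderiv ℝ k₀) atTop S) ∧
    (∀ j, Ss j ∩ ball x (R / 2) = (range fun ξ => x + u ξ + w (k j ξ)) ∩ ball x (R / 2)) ∧
    S₀ ∩ ball x (R / 2) = (range fun ξ => x + u ξ + w (k₀ ξ)) ∩ ball x (R / 2)

lemma Good.sub {m n : ℕ} {R α : ℝ} {Ss : ℕ → Set (ES n)} {S₀ : Set (ES n)} {x : ES n}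
    (h : Good m n R α Ss S₀ x) {φ : ℕ → ℕ} (hφ : StrictMono φ) :
    Good m n R α (fun j => Ss (φ j)) S₀ x := by
  obtain ⟨u, w, K, C, k, k₀, h1, h2, h3, h4, h5, h6, h7, h8⟩ := h
  exact ⟨u, w, K, C, fun j => k (φ j), k₀, h1, h2, fun j => h3 _, h4,
    fun S hS s hs => hφ.tendsto_atTop.eventually (h5 S hS s hs),
    fun S hS s hs => hφ.tendsto_atTop.eventually (h6 S hS s hs), fun j => h7 _, h8⟩

lemma ball_restrict {E : Type*} [MetricSpace E] {A B : Set E} {x y : E} {r s : ℝ}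
    (h : A ∩ ball x r = B ∩ ball x r) (hs : ball y s ⊆ ball x r) : A ∩ ball y s = B ∩ ball y s := by
  have h1 : ball y s = ball x r ∩ ball y s := (inter_eq_right.2 hs).symm
  rw [h1, ← inter_assoc, ← inter_assoc, h]

lemma exists_good {m n : ℕ} {R L d α : ℝ} (hR : 0 < R) (hL : 0 ≤ L) (hα : 0 < α)
    {Ss : ℕ → Set (ES n)}
    {S₀ : Set (ES n)} (hSs : ∀ j, InClassC1 m n R L d α (Ss j)) (hn₀ : S₀.Nonempty)
    (hc₀ : IsCompact S₀)
    (h : Tendsto (fun j => hausdorffDist (Ss j) S₀) atTop (𝓝 0)) {x : ES n} (hx : x ∈ S₀) :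
    ∃ φ : ℕ → ℕ, StrictMono φ ∧ Good m n R α (fun j => Ss (φ j)) S₀ x := by
  obtain ⟨φ, hφ, y, u, w, g, u₀, w₀, hy, hu, hw, hfr, hall⟩ := setup hL hα.le hSs hn₀ hc₀ h hx
  have e1 : ∀ᶠ j in atTop, ‖u j - u₀‖ ≤ 1 / 4 := by
    filter_upwards [Metric.tendsto_nhds.1 hu (1 / 4) (by norm_num)] with j hj
    rw [← dist_eq_norm]; exact hj.le
  have e2 : ∀ᶠ j in atTop, ‖w j - w₀‖ ≤ 1 / 4 := by
    filter_upwards [Metric.tendsto_nhds.1 hw (1 / 4) (by norm_num)] with j hj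
    rw [← dist_eq_norm]; exact hj.le
  have e3 : ∀ᶠ j in atTop, dist (y j) x ≤ R / 2 := by
    filter_upwards [Metric.tendsto_nhds.1 hy (R / 2) (by positivity)] with j hj
    exact hj.le
  obtain ⟨J, hJ⟩ := eventually_atTop.1 (e1.and (e2.and e3))
  have hJ' : ∀ j, _ := fun j => hJ (j + J) (Nat.le_add_left _ _)
  choose k hk hk0 hkr using fun j => tilt hfr (hall (j + J)).1 (hJ' j).1 (hJ' j).2.1 hL hα.le
    (hall (j + J)).2.1 (hall (j + J)).2.2.1 x (y (j + J))
  obtain ⟨ψ, hψ, k₀, hk₀, hku, hku'⟩ := aa1 hα k hk (M := 5 * (R / 2)) (fun j => (hk0 j).trans (by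
    have := (hJ' j).2.2
    rw [dist_eq_norm] at this
    linarith))
  have hmono : StrictMono fun j => φ (ψ j + J) := hφ.comp fun a b hab => by
    have := hψ hab
    omega
  have h' : Tendsto (fun j => hausdorffDist (Ss (φ (ψ j + J))) S₀) atTop (𝓝 0) :=
    h.comp hmono.tendsto_atTop
  have hpat : ∀ j, Ss (φ (ψ j + J)) ∩ ball x (R / 2) =
      (range fun ξ => x + u₀ ξ + w₀ (k (ψ j) ξ)) ∩ ball x (R / 2) := by
    intro j
    rw [← hkr (ψ j)]
    refine ball_restrict (hall (ψ j + J)).2.2.2.2 (ball_subset_ball' ?_)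
    have := (hJ' (ψ j)).2.2
    rw [dist_comm] at this
    linarith
  refine ⟨_, hmono, u₀, w₀, _, _, fun j => k (ψ j), k₀, hfr, ?_, fun j => hk _, hk₀, hku, hku',
    hpat, ?_⟩
  · positivity
  · exact graph_limit (Ss := fun j => Ss (φ (ψ j + J)))
      (hconv1 (fun j => (hSs _).1) (fun j => (hSs _).2.1) hn₀ hc₀ h')
      (hconv2 (fun j => (hSs _).1) (fun j => (hSs _).2.1) hn₀ hc₀ h')
      (fun j => hfr) tendsto_const_nhds tendsto_const_nhds
      tendsto_const_nhds (fun j a b => (hk (ψ j)).lip a b)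
      (fun a => (hku {a} isCompact_singleton).tendsto_at rfl) hpat

lemma exists_good_finset {m n : ℕ} {R L d α : ℝ} (hR : 0 < R) (hL : 0 ≤ L) (hα : 0 < α)
    {Ss : ℕ → Set (ES n)}
    {S₀ : Set (ES n)} (hSs : ∀ j, InClassC1 m n R L d α (Ss j)) (hn₀ : S₀.Nonempty)
    (hc₀ : IsCompact S₀)
    (h : Tendsto (fun j => hausdorffDist (Ss j) S₀) atTop (𝓝 0)) (F : Set (ES n))
    (hF : F.Finite) (hFS : F ⊆ S₀) :
    ∃ φ : ℕ → ℕ, StrictMono φ ∧ ∀ x ∈ F, Good m n R α (fun j => Ss (φ j)) S₀ x := by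
  induction F, hF using Set.Finite.induction_on with
  | empty => exact ⟨id, strictMono_id, fun x hx => hx.elim⟩
  | @insert a F _ _ ih =>
    obtain ⟨φ, hφ, hg⟩ := ih ((subset_insert _ _).trans hFS)
    obtain ⟨ψ, hψ, hg'⟩ := exists_good (Ss := fun j => Ss (φ j)) hR hL hα (fun j => hSs _) hn₀ hc₀
      (h.comp hφ.tendsto_atTop) (hFS (mem_insert _ _))
    refine ⟨φ ∘ ψ, hφ.comp hψ, fun x hx => ?_⟩
    rcases hx with rfl | hx
    · exact hg'
    · exact (hg x hx).sub hψ

theorem c1alpha_class_compactness (m n : ℕ) (R L d α : ℝ)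
    (hm : 1 ≤ m) (hmn : m < n) (hR : 0 < R) (hL : 0 < L) (hd : 0 < d)
    (hα : 0 < α) (hα1 : α ≤ 1)
    (Ss : ℕ → Set (EuclideanSpace ℝ (Fin n)))
    (hSs : ∀ j, InClassC1 m n R L d α (Ss j)) :
    ∃ φ : ℕ → ℕ, StrictMono φ ∧
      ∃ S₀ : Set (EuclideanSpace ℝ (Fin n)), InClassC1 m n R L d α S₀ ∧
        GraphPatchConverges m n α (fun k => Ss (φ k)) S₀ := by
  have hK := TopologicalSpace.NonemptyCompacts.isCompact_subsets_of_isCompact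
    (isCompact_closedBall (0 : ES n) d)
  obtain ⟨Q, hQ, φ, hφ, hlim⟩ := hK.tendsto_subseq
    (x := fun j => (⟨⟨Ss j, (hSs j).2.1⟩, (hSs j).1⟩ : TopologicalSpace.NonemptyCompacts (ES n)))
    (fun j => (hSs j).2.2.1)
  let S₀ : Set (ES n) := SetLike.coe Q
  have hn₀ : S₀.Nonempty := Q.nonempty
  have hc₀ : IsCompact S₀ := Q.isCompact
  have h1 : Tendsto (fun j => hausdorffDist (Ss (φ j)) S₀) atTop (𝓝 0) :=
    tendsto_iff_dist_tendsto_zero.1 hlim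
  have hmem : InClassC1 m n R L d α S₀ :=
    limit_mem hL.le hα (Ss := fun j => Ss (φ j)) (fun j => hSs _) hn₀ hc₀ hQ h1
  obtain ⟨F, hFS, hFfin, hcov⟩ := hc₀.finite_cover_balls (e := R / 4) (by positivity)
  obtain ⟨ψ, hψ, hgood⟩ := exists_good_finset (Ss := fun j => Ss (φ j)) hR hL.le hα
    (fun j => hSs _) hn₀ hc₀ h1 F hFfin hFS
  refine ⟨φ ∘ ψ, hφ.comp hψ, S₀, hmem, h1.comp hψ.tendsto_atTop, ⟨hn₀, hc₀, fun x hx => ?_⟩,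
    0, R / 4, by positivity, fun x hx => ?_⟩
  · obtain ⟨T, hT, f, hf, -, -, -, hho, hp⟩ := hmem.2.2.2 x hx
    exact ⟨R, hR, T, hT, f, hf, ⟨L, hho⟩, hp⟩
  · obtain ⟨x₀, hx₀, hxb⟩ := mem_iUnion₂.1 (hcov hx)
    obtain ⟨u, w, K, C, k, k₀, hfr, hC, hk, hk₀, hku, hku', hp, hp₀⟩ := hgood x₀ hx₀
    obtain ⟨θ, K', C', hθ, hC', hθid, M, hM⟩ := exists_theta (ES m) hα hα1
      (show 0 < R / 4 by positivity)
    obtain ⟨T, hT, p, q, hpn, hqn, hrange⟩ := hfr.back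
    have hRR : R / 2 = 2 * (R / 4) := by ring
    rw [hRR] at hp₀
    simp only [hRR] at hp
    set ξ₀ := u.adjoint (x - x₀)
    set v₀ := w.adjoint (x - x₀)
    let Θ : T → ES m := fun t => θ (p t) + ξ₀
    have hΘ : Reg K' C' α Θ := by
      have h2 := (hθ.rcomp hα.le hC' p hpn 0).lcomp hα.le hC' (ContinuousLinearMap.id ℝ (ES m))
        ContinuousLinearMap.norm_id_le ξ₀
      simpa [Θ] using h2
    have hΘS : ∀ t, Θ t ∈ closedBall (0 : ES m) (M + ‖ξ₀‖) := by
      intro t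
      rw [mem_closedBall_zero_iff]
      exact (norm_add_le _ _).trans (by linarith [hM (p t)])
    have hreg : ∀ g : ES m → ES (n - m), Reg K C α g →
        C1Holder α (fun t => q (g (Θ t)) + q (-v₀)) := by
      intro g hg
      have hK' := hΘ.K0
      have hK0 := hg.K0
      have h2 := (hg.comp hα.le hC hΘ).lcomp hα.le (by positivity) q hqn (q (-v₀))
      exact ⟨h2.cd, _, h2.ho⟩
    have hpatch : ∀ (S : Set (ES n)) (g : ES m → ES (n - m)),
        S ∩ ball x₀ (2 * (R / 4)) = (range fun ξ => x₀ + u ξ + w (g ξ)) ∩ ball x₀ (2 * (R / 4)) →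
        S ∩ ball x (R / 4) = (range fun t : T => x + (t : ES n) +
          ((q (g (Θ t)) + q (-v₀) : Tᗮ) : ES n)) ∩ ball x (R / 4) := by
      intro S g hS
      rw [patch_shift hfr hS hxb hθid, hrange]
      simp only [sub_eq_add_neg, map_add, Θ, ξ₀, v₀]
    refine ⟨T, by rw [hT]; simp, fun j t => q (k j (Θ t)) + q (-v₀), fun t => q (k₀ (Θ t)) + q (-v₀),
      ⟨hreg _ hk₀, hpatch _ _ hp₀⟩, fun j _ => ⟨hreg _ (hk j), hpatch _ _ (hp j)⟩, ?_⟩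
    intro α' hα' hα'1 ε hε
    exact close_lemma hα' hα'1 hC hC' hk hk₀ (hku _ (isCompact_closedBall 0 (M + ‖ξ₀‖)))
      (hku' _ (isCompact_closedBall 0 (M + ‖ξ₀‖))) hΘ hΘS q hqn (q (-v₀)) hε
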